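/- Let Λ be an Artin algebra and M a finitely generated Λ-module. Then Add(M) is an n-cluster tilting subcategory of Mod-Λ if and only if add(M) is an n-cluster tilting subcategory of mod-Λ. -/

import Mathlib

open CategoryTheory Limits DirectSum

namespace Paper

variable {Λ : Type} [Ring Λ]

/-- `N` is a direct summand of `P` (there is a section/retraction pair). -/
def IsSummand (N P : ModuleCat Λ) : Prop :=
  ∃ (s : N ⟶ P) (r : P ⟶ N), s ≫ r = 𝟙 N

/-- `Add 𝓧`: all direct summands of arbitrary direct sums of objects of `𝓧`. -/
def AddCl (𝓧 : Set (ModuleCat Λ)) : Set (ModuleCat Λ) :=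
  {N | ∃ (ι : Type) (X : ι → ModuleCat Λ), (∀ i, X i ∈ 𝓧) ∧
        IsSummand N (ModuleCat.of Λ (⨁ i, X i))}

/-- `add 𝓧`: all direct summands of finite direct sums of objects of `𝓧`. -/
def addCl (𝓧 : Set (ModuleCat Λ)) : Set (ModuleCat Λ) :=
  {N | ∃ (k : ℕ) (X : Fin k → ModuleCat Λ), (∀ i, X i ∈ 𝓧) ∧
        IsSummand N (ModuleCat.of Λ (⨁ i, X i))}

/-- Vanishing of `Ext^i(X, Y)` in `Mod Λ`. -/
def extZero (i : ℕ) (X Y : ModuleCat Λ) : Prop :=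
  Limits.IsZero (((Ext ℤ (ModuleCat Λ) i).obj (Opposite.op X)).obj Y)

/-- `𝓜` is an `n`-cluster tilting subcategory of the full subcategory `𝓐 ⊆ Mod Λ`:
it is a generating-cogenerating, functorially finite subcategory of `𝓐` which
coincides with both `Ext`-orthogonality classes (for `1 ≤ i ≤ n-1`) inside `𝓐`. -/
structure IsNClusterTilting (n : ℕ) (𝓐 𝓜 : Set (ModuleCat Λ)) : Prop where
  subset : 𝓜 ⊆ 𝓐
  generating : ∀ A ∈ 𝓐, ∃ M ∈ 𝓜, ∃ f : M ⟶ A, Function.Surjective f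
  cogenerating : ∀ A ∈ 𝓐, ∃ M ∈ 𝓜, ∃ f : A ⟶ M, Function.Injective f
  contFinite : ∀ A ∈ 𝓐, ∃ M ∈ 𝓜, ∃ f : M ⟶ A,
    ∀ N ∈ 𝓜, ∀ g : N ⟶ A, ∃ h : N ⟶ M, h ≫ f = g
  covFinite : ∀ A ∈ 𝓐, ∃ M ∈ 𝓜, ∃ f : A ⟶ M,
    ∀ N ∈ 𝓜, ∀ g : A ⟶ N, ∃ h : M ⟶ N, f ≫ h = g
  char_left : ∀ X ∈ 𝓐, (X ∈ 𝓜 ↔ ∀ i, 0 < i → i < n → ∀ M ∈ 𝓜, extZero i X M)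
  char_right : ∀ X ∈ 𝓐, (X ∈ 𝓜 ↔ ∀ i, 0 < i → i < n → ∀ M ∈ 𝓜, extZero i M X)

/-- The class of finitely generated Λ-modules (the subcategory `mod Λ`). -/
def modFG (Λ : Type) [Ring Λ] : Set (ModuleCat Λ) := {M | Module.Finite Λ M}


/-!
STATEMENT 4: For an Artin algebra Λ and a finitely generated Λ-module `M`,
`Add M` is an `n`-cluster tilting subcategory of `Mod Λ` if and only if `add M`
is an `n`-cluster tilting subcategory of `mod Λ`.
-/

section SplitPart

/-- Equational form of flatness over a (noncommutative) ring. -/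
def EqFlat (S : Type) [Ring S] (F : Type) [AddCommGroup F] [Module S F] : Prop :=
  ∀ (r : ℕ) (j : Fin r → S) (x : Fin r → F), ∑ a, j a • x a = 0 →
    ∃ (k : ℕ) (c : Fin r → Fin k → S) (y : Fin k → F),
      (∀ a, x a = ∑ b, c a b • y b) ∧ ∀ b, ∑ a, j a * c a b = 0

lemma eqFlat_inf_smul {S : Type} [Ring S] {E F : Type} [AddCommGroup E] [Module S E]
    [AddCommGroup F] [Module S F] (f : E →ₗ[S] F) (hf : Function.Surjective f)
    (hF : EqFlat S F) (I : Ideal S) {z : E} (hz : f z = 0)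
    (hzI : z ∈ I • (⊤ : Submodule S E)) : z ∈ I • LinearMap.ker f := by
  have key : ∃ (r : ℕ) (j : Fin r → S) (e : Fin r → E), (∀ a, j a ∈ I) ∧
      z = ∑ a, j a • e a := by
    clear hz
    refine Submodule.smul_induction_on hzI ?_ ?_
    · intro r hr n hn
      exact ⟨1, fun _ => r, fun _ => n, fun _ => hr, by simp⟩
    · intro x y hx hy
      obtain ⟨r, j, e, h1, rfl⟩ := hx
      obtain ⟨r', j', e', h1', rfl⟩ := hy
      refine ⟨r + r', Fin.append j j', Fin.append e e', ?_, ?_⟩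
      · intro a
        refine Fin.addCases (fun i => ?_) (fun i => ?_) a
        · simpa using h1 i
        · simpa using h1' i
      · simp [Fin.sum_univ_add]
  obtain ⟨r, j, e, hj, rfl⟩ := key
  obtain ⟨k, c, y, hx, hc⟩ := hF r j (fun a => f (e a)) (by simpa using hz)
  choose y' hy' using fun b => hf (y b)
  have h0 : ∑ a, j a • (∑ b, c a b • y' b) = 0 := by
    simp only [Finset.smul_sum, smul_smul]
    rw [Finset.sum_comm]
    simp only [← Finset.sum_smul, hc, zero_smul, Finset.sum_const_zero]
  have h1 : ∑ a, j a • e a = ∑ a, j a • (e a - ∑ b, c a b • y' b) := by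
    simp only [smul_sub, Finset.sum_sub_distrib, h0, sub_zero]
  rw [h1]
  refine Submodule.sum_mem _ fun a _ => Submodule.smul_mem_smul (hj a) ?_
  simp [hx, hy', map_sum]

lemma isSemisimple_quot_jac {S : Type} [Ring S] [IsSemiprimaryRing S] (E : Type) [AddCommGroup E]
    [Module S E] : IsSemisimpleModule S (E ⧸ (Ring.jacobson S • (⊤ : Submodule S E))) := by
  have h : Module.IsTorsionBySet S (E ⧸ (Ring.jacobson S • (⊤ : Submodule S E)))
      (Ring.jacobson S) := by
    rw [Module.isTorsionBySet_quotient_iff]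
    exact fun m i hi ↦ Submodule.smul_mem_smul hi trivial
  let _ := h.module
  exact (h.semilinearMap.isSemisimpleModule_iff_of_bijective Function.bijective_id).2
      inferInstance

lemma exists_section_aux {S : Type} [Ring S] [IsSemiprimaryRing S] {F : Type} [AddCommGroup F]
    [Module S F] (hF : EqFlat S F) (m : ℕ) : ∀ (E : Type) [AddCommGroup E] [Module S E]
    (f : E →ₗ[S] F), Function.Surjective f → (Ring.jacobson S) ^ m • LinearMap.ker f = ⊥ →
    ∃ g : F →ₗ[S] E, f ∘ₗ g = LinearMap.id := by
  induction m with
  | zero =>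
    intro E _ _ f hf hk
    rw [Submodule.pow_zero, Ideal.one_eq_top, Submodule.top_smul] at hk
    let e := LinearEquiv.ofBijective f ⟨LinearMap.ker_eq_bot.1 hk, hf⟩
    exact ⟨e.symm, LinearMap.ext fun x => e.apply_symm_apply x⟩
  | succ m ih =>
    intro E _ _ f hf hk
    set J := Ring.jacobson S
    set JE := J • (⊤ : Submodule S E)
    have : IsSemisimpleModule S (E ⧸ JE) := isSemisimple_quot_jac E
    obtain ⟨C, hC⟩ := exists_isCompl ((LinearMap.ker f).map JE.mkQ)
    let E' := C.comap JE.mkQ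
    have hsurj : Function.Surjective (f ∘ₗ E'.subtype) := by
      intro y
      obtain ⟨e, rfl⟩ := hf y
      have : JE.mkQ e ∈ (LinearMap.ker f).map JE.mkQ ⊔ C := by rw [hC.sup_eq_top]; trivial
      obtain ⟨u, hu, v, hv, huv⟩ := Submodule.mem_sup.1 this
      obtain ⟨k, hk, rfl⟩ := hu
      refine ⟨⟨e - k, ?_⟩, ?_⟩
      · change JE.mkQ (e - k) ∈ C
        rw [map_sub, ← huv]
        simpa using hv
      · have : f k = 0 := hk
        simp [this]
    have hker : (LinearMap.ker (f ∘ₗ E'.subtype)).map E'.subtype ≤ J • LinearMap.ker f := by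
      rintro _ ⟨z, hz, rfl⟩
      have hz0 : f z = 0 := hz
      refine eqFlat_inf_smul f hf hF J hz0 ?_
      have h1 : JE.mkQ (z : E) ∈ (LinearMap.ker f).map JE.mkQ ⊓ C :=
        ⟨⟨z, hz0, rfl⟩, z.2⟩
      rw [hC.inf_eq_bot] at h1
      simpa using h1
    obtain ⟨g, hg⟩ := ih E' (f ∘ₗ E'.subtype) hsurj (by
      rw [eq_bot_iff]
      intro z hz
      have h2 : (z : E) ∈ (J ^ m • LinearMap.ker (f ∘ₗ E'.subtype)).map E'.subtype := ⟨z, hz, rfl⟩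
      rw [Submodule.map_smul''] at h2
      have h3 : (z : E) ∈ J ^ m • (J • LinearMap.ker f) := Submodule.smul_mono le_rfl hker h2
      rw [← Submodule.mul_smul, ← Submodule.pow_succ, hk] at h3
      simpa using h3)
    exact ⟨E'.subtype ∘ₗ g, by rw [← LinearMap.comp_assoc, hg]⟩

lemma exists_section_of_eqFlat {S : Type} [Ring S] [IsSemiprimaryRing S] {F : Type} [AddCommGroup F]
    [Module S F] (hF : EqFlat S F) (E : Type) [AddCommGroup E] [Module S E]
    (f : E →ₗ[S] F) (hf : Function.Surjective f) :
    ∃ g : F →ₗ[S] E, f ∘ₗ g = LinearMap.id := by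
  obtain ⟨m, hm⟩ := (IsSemiprimaryRing.isNilpotent : IsNilpotent (Ring.jacobson S))
  exact exists_section_aux hF m E f hf (by rw [hm]; simp)

end SplitPart

section HomPart

/-- `Λ` is a direct summand of `M^k`. -/
def IsGen (Λ : Type) [Ring Λ] (M : Type) [AddCommGroup M] [Module Λ M] : Prop :=
  ∃ (k : ℕ) (u : Fin k → M) (v : Fin k → (M →ₗ[Λ] Λ)), ∑ i, v i (u i) = 1

/-- Every map from a finitely generated module to `X` factors through some `M^k`. -/
def MFlat (Λ : Type) [Ring Λ] (M X : Type) [AddCommGroup M] [Module Λ M]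
    [AddCommGroup X] [Module Λ X] : Prop :=
  ∀ (F : Type) [AddCommGroup F] [Module Λ F], Module.Finite Λ F → ∀ φ : F →ₗ[Λ] X,
    ∃ (k : ℕ) (α : F →ₗ[Λ] (Fin k → M)) (β : (Fin k → M) →ₗ[Λ] X), φ = β ∘ₗ α

variable {Λ : Type} [Ring Λ] {M : Type} [AddCommGroup M] [Module Λ M]

abbrev EndOp (Λ : Type) [Ring Λ] (M : Type) [AddCommGroup M] [Module Λ M] : Type :=
  (Module.End Λ M)ᵈᵐᵃ

lemma eqFlat_hom [Module.Finite Λ M] {X : Type} [AddCommGroup X] [Module Λ X]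
    (hX : MFlat Λ M X) : EqFlat (EndOp Λ M) (M →ₗ[Λ] X) := by
  intro r j x h
  let jm : M →ₗ[Λ] (Fin r → M) := LinearMap.pi fun a => (DomMulAct.mk.symm (j a) : Module.End Λ M)
  let xm : (Fin r → M) →ₗ[Λ] X := ∑ a, x a ∘ₗ LinearMap.proj a
  have hx : LinearMap.range jm ≤ LinearMap.ker xm := by
    rintro _ ⟨m, rfl⟩
    have := LinearMap.congr_fun h m
    simpa [jm, xm, DomMulAct.smul_linearMap_apply] using this
  obtain ⟨k, α, β, hαβ⟩ := hX ((Fin r → M) ⧸ LinearMap.range jm) inferInstance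
    ((LinearMap.range jm).liftQ xm hx)
  classical
  refine ⟨k, fun a b => DomMulAct.mk (LinearMap.proj b ∘ₗ α ∘ₗ (LinearMap.range jm).mkQ ∘ₗ
    LinearMap.single Λ (fun _ => M) a), fun b => β ∘ₗ LinearMap.single Λ (fun _ => M) b, ?_, ?_⟩
  · intro a
    ext m
    have h1 : x a m = xm (Pi.single a m) := by
      simp [xm, Pi.single_apply, apply_ite]
    have h2 : xm (Pi.single a m) =
        β (α ((LinearMap.range jm).mkQ (Pi.single a m))) := by
      rw [← LinearMap.comp_apply β, ← hαβ]; simp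
    rw [h1, h2]
    simp only [LinearMap.sum_apply, DomMulAct.mk_smul_linearMap_apply]
    conv_lhs => rw [← Finset.univ_sum_single (α ((LinearMap.range jm).mkQ (Pi.single a m)))]
    simp
  · intro b
    apply DomMulAct.mk.symm.injective
    ext m
    have h3 : (LinearMap.range jm).mkQ (jm m) = 0 := by simp
    have h4 : jm m = ∑ a, Pi.single a ((DomMulAct.mk.symm (j a) : Module.End Λ M) m) := by
      rw [Finset.univ_sum_single]; rfl
    have h5 : α ((LinearMap.range jm).mkQ (jm m)) b = 0 := by rw [h3]; simp
    rw [h4] at h5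
    have h6 : ∀ (t : Fin r → EndOp Λ M), (DomMulAct.mk.symm (∑ a, t a) : Module.End Λ M) m =
      ∑ a, (DomMulAct.mk.symm (t a) : Module.End Λ M) m := by
      intro t
      have : (DomMulAct.mk.symm (∑ a, t a) : Module.End Λ M) = ∑ a, DomMulAct.mk.symm (t a) :=
        map_sum (MulOpposite.opAddEquiv (α := Module.End Λ M)).symm t _
      rw [this]; simp
    rw [h6]
    refine Eq.trans ?_ h5
    simp [map_sum]

/-- An `M`-flat module: every `Hom(M,-)`-epimorphism onto it splits. -/
lemma exists_section_of_mflat [Module.Finite Λ M] (hS : IsSemiprimaryRing (EndOp Λ M))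
    (hgen : IsGen Λ M)
    {X E : Type} [AddCommGroup X] [Module Λ X] [AddCommGroup E] [Module Λ E] (hX : MFlat Λ M X)
    (p : E →ₗ[Λ] X) (hp : ∀ g : M →ₗ[Λ] X, ∃ h : M →ₗ[Λ] E, p ∘ₗ h = g) :
    ∃ s : X →ₗ[Λ] E, p ∘ₗ s = LinearMap.id := by
  let pm : (M →ₗ[Λ] E) →ₗ[EndOp Λ M] (M →ₗ[Λ] X) :=
    { toFun := fun f => p ∘ₗ f
      map_add' := fun f g => LinearMap.comp_add _ _ _
      map_smul' := fun c f => rfl }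
  obtain ⟨σ, hσ⟩ := exists_section_of_eqFlat (eqFlat_hom hX) _ pm hp
  obtain ⟨k, u, v, huv⟩ := hgen
  have hσp : ∀ g, p ∘ₗ σ g = g := fun g => LinearMap.congr_fun hσ g
  have hσc : ∀ (g : M →ₗ[Λ] X) (c : Module.End Λ M), σ (g ∘ₗ c) = σ g ∘ₗ c := fun g c =>
    σ.map_smul (DomMulAct.mk c) g
  let φ : X → Fin k → (M →ₗ[Λ] X) := fun x i => LinearMap.toSpanSingleton Λ X x ∘ₗ v i
  refine ⟨⟨⟨fun x => ∑ i, σ (φ x i) (u i), ?_⟩, ?_⟩, ?_⟩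
  · intro x y
    rw [← Finset.sum_add_distrib]
    refine Finset.sum_congr rfl fun i _ => ?_
    rw [← LinearMap.add_apply, ← map_add]
    congr 2
    ext m; simp [φ]
  · intro l x
    have h1 : ∀ i, φ (l • x) i = ∑ j, φ x j ∘ₗ
        (LinearMap.toSpanSingleton Λ M (l • u j) ∘ₗ v i : Module.End Λ M) := by
      intro i
      ext m
      simp only [φ, LinearMap.comp_apply, LinearMap.toSpanSingleton_apply, LinearMap.sum_apply,
        map_smul]
      simp only [smul_smul, ← Finset.sum_smul, ← Finset.mul_sum]
      rw [huv, mul_one]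
    simp only [h1, map_sum, hσc, RingHom.id_apply, Finset.smul_sum, LinearMap.sum_apply]
    rw [Finset.sum_comm]
    refine Finset.sum_congr rfl fun j _ => ?_
    simp only [LinearMap.comp_apply, LinearMap.toSpanSingleton_apply, map_smul]
    rw [← Finset.sum_smul, huv, one_smul]
  · ext x
    have h2 : ∀ i, p (σ (φ x i) (u i)) = v i (u i) • x := fun i =>
      LinearMap.congr_fun (hσp (φ x i)) (u i)
    simp [h2, ← Finset.sum_smul, huv]

end HomPart
section AddPart

variable {Λ : Type} [Ring Λ]

/-- unbundled membership in `Add M` -/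
def IsAdd (Λ : Type) [Ring Λ] (M X : Type) [AddCommGroup M] [Module Λ M]
    [AddCommGroup X] [Module Λ X] : Prop :=
  ∃ (ι : Type) (s : X →ₗ[Λ] (ι →₀ M)) (r : (ι →₀ M) →ₗ[Λ] X), r ∘ₗ s = LinearMap.id

/-- unbundled membership in `add M` -/
def IsFadd (Λ : Type) [Ring Λ] (M X : Type) [AddCommGroup M] [Module Λ M]
    [AddCommGroup X] [Module Λ X] : Prop :=
  ∃ (k : ℕ) (s : X →ₗ[Λ] (Fin k → M)) (r : (Fin k → M) →ₗ[Λ] X), r ∘ₗ s = LinearMap.id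

/-- The finiteness properties of a module over an Artin algebra that are used. -/
structure Good (Λ : Type) [Ring Λ] (M : Type) [AddCommGroup M] [Module Λ M] : Prop where
  noeth : IsNoetherianRing Λ
  fin : Module.Finite Λ M
  left : ∀ (F : Type) [AddCommGroup F] [Module Λ F], Module.Finite Λ F →
    ∃ (k : ℕ) (g : F →ₗ[Λ] (Fin k → M)), ∀ f : F →ₗ[Λ] M, ∃ c : (Fin k → M) →ₗ[Λ] M, c ∘ₗ g = f
  right : ∀ (F : Type) [AddCommGroup F] [Module Λ F], Module.Finite Λ F →
    ∃ (k : ℕ) (g : (Fin k → M) →ₗ[Λ] F), ∀ f : M →ₗ[Λ] F, ∃ c : M →ₗ[Λ] (Fin k → M), g ∘ₗ c = f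
  semi : IsSemiprimaryRing (EndOp Λ M)

section fromR

lemma hom_finite (R : Type) [CommRing R] [IsArtinianRing R] [Algebra R Λ] [Module.Finite R Λ]
    (M N : Type) [AddCommGroup M] [Module Λ M] [AddCommGroup N] [Module Λ N]
    [Module R M] [IsScalarTower R Λ M] [Module R N] [IsScalarTower R Λ N]
    [SMulCommClass Λ R N]
    [Module.Finite Λ M] [Module.Finite Λ N] : Module.Finite R (M →ₗ[Λ] N) := by
  have : Module.Finite R N := Module.Finite.trans Λ N
  obtain ⟨k, s, hs⟩ := Module.Finite.exists_fin (R := Λ) (M := M)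
  let ev : (M →ₗ[Λ] N) →ₗ[R] (Fin k → N) :=
    { toFun := fun f i => f (s i)
      map_add' := fun f g => rfl
      map_smul' := fun f g => rfl }
  refine Module.Finite.of_injective ev ?_
  intro f g h
  refine LinearMap.ext_on_range hs fun i => congr_fun h i

lemma good_of_artin (R : Type) [CommRing R] [IsArtinianRing R] [Algebra R Λ] [Module.Finite R Λ]
    (M : Type) [AddCommGroup M] [Module Λ M] (hM : Module.Finite Λ M) :
    Good Λ M := by
  let iM : Module R M := Module.compHom M (algebraMap R Λ)
  have tM : IsScalarTower R Λ M := ⟨fun r l m => by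
    rw [Algebra.smul_def, mul_smul]; rfl⟩
  have cM : SMulCommClass Λ R M := IsScalarTower.to_smulCommClass'
  refine ⟨?_, hM, ?_, ?_, ?_⟩
  · exact isNoetherian_of_tower R inferInstance
  · intro F _ _ hF
    let iF : Module R F := Module.compHom F (algebraMap R Λ)
    have tF : IsScalarTower R Λ F := ⟨fun r l m => by
      rw [Algebra.smul_def, mul_smul]; rfl⟩
    have := hom_finite (Λ := Λ) R F M
    obtain ⟨k, s, hs⟩ := Module.Finite.exists_fin (R := R) (M := F →ₗ[Λ] M)
    refine ⟨k, LinearMap.pi s, fun f => ?_⟩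
    have hf : f ∈ Submodule.span R (Set.range s) := by rw [hs]; trivial
    obtain ⟨c, rfl⟩ := (Submodule.mem_span_range_iff_exists_fun R).1 hf
    refine ⟨∑ i, c i • LinearMap.proj i, ?_⟩
    ext x; simp
  · intro F _ _ hF
    let iF : Module R F := Module.compHom F (algebraMap R Λ)
    have tF : IsScalarTower R Λ F := ⟨fun r l m => by
      rw [Algebra.smul_def, mul_smul]; rfl⟩
    have cF : SMulCommClass Λ R F := IsScalarTower.to_smulCommClass'
    have := hom_finite (Λ := Λ) R M F
    obtain ⟨k, s, hs⟩ := Module.Finite.exists_fin (R := R) (M := M →ₗ[Λ] F)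
    refine ⟨k, ∑ i, s i ∘ₗ LinearMap.proj i, fun f => ?_⟩
    have hf : f ∈ Submodule.span R (Set.range s) := by rw [hs]; trivial
    obtain ⟨c, rfl⟩ := (Submodule.mem_span_range_iff_exists_fun R).1 hf
    refine ⟨LinearMap.pi fun i => c i • LinearMap.id, ?_⟩
    ext x
    have h1 : ∀ i, s i (c i • x) = c i • s i x := fun i => by
      rw [← algebraMap_smul Λ (c i) x, map_smul, algebraMap_smul]
    simp [h1]
  · have h1 : Module.Finite R (Module.End Λ M) := hom_finite R M M
    have h2 : Module.Finite R (Module.End Λ M)ᵐᵒᵖ :=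
      Module.Finite.equiv (MulOpposite.opLinearEquiv R)
    have h3 : IsArtinianRing (Module.End Λ M)ᵐᵒᵖ := isArtinian_of_tower R inferInstance
    have h4 : IsSemiprimaryRing (Module.End Λ M)ᵐᵒᵖ := inferInstance
    exact h4

end fromR

variable {M : Type} [AddCommGroup M] [Module Λ M]

lemma IsFadd.pow (k : ℕ) : IsFadd Λ M (Fin k → M) := ⟨k, LinearMap.id, LinearMap.id, rfl⟩

lemma IsFadd.self : IsFadd Λ M M :=
  ⟨1, LinearMap.pi fun _ => LinearMap.id, LinearMap.proj 0, by ext; simp⟩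

lemma IsAdd.finsupp (ι : Type) : IsAdd Λ M (ι →₀ M) := ⟨ι, LinearMap.id, LinearMap.id, rfl⟩

lemma IsAdd.of_summand {X Y : Type} [AddCommGroup X] [Module Λ X] [AddCommGroup Y] [Module Λ Y]
    (hY : IsAdd Λ M Y) (s : X →ₗ[Λ] Y) (r : Y →ₗ[Λ] X) (h : r ∘ₗ s = LinearMap.id) :
    IsAdd Λ M X := by
  obtain ⟨ι, s', r', h'⟩ := hY
  refine ⟨ι, s' ∘ₗ s, r ∘ₗ r', ?_⟩
  rw [LinearMap.comp_assoc, ← LinearMap.comp_assoc s, h', LinearMap.id_comp, h]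

lemma IsFadd.of_summand {X Y : Type} [AddCommGroup X] [Module Λ X] [AddCommGroup Y] [Module Λ Y]
    (hY : IsFadd Λ M Y) (s : X →ₗ[Λ] Y) (r : Y →ₗ[Λ] X) (h : r ∘ₗ s = LinearMap.id) :
    IsFadd Λ M X := by
  obtain ⟨ι, s', r', h'⟩ := hY
  refine ⟨ι, s' ∘ₗ s, r ∘ₗ r', ?_⟩
  rw [LinearMap.comp_assoc, ← LinearMap.comp_assoc s, h', LinearMap.id_comp, h]

lemma IsFadd.isAdd {X : Type} [AddCommGroup X] [Module Λ X] (h : IsFadd Λ M X) : IsAdd Λ M X := by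
  obtain ⟨k, s, r, h⟩ := h
  exact (IsAdd.finsupp (Fin k)).of_summand
    ((Finsupp.linearEquivFunOnFinite Λ M (Fin k)).symm.toLinearMap ∘ₗ s)
    (r ∘ₗ (Finsupp.linearEquivFunOnFinite Λ M (Fin k)).toLinearMap) (by
      ext x
      simpa using LinearMap.congr_fun h x)

lemma IsFadd.prod_pow {X : Type} [AddCommGroup X] [Module Λ X] (h : IsFadd Λ M X) (l : ℕ) :
    IsFadd Λ M (X × (Fin l → M)) := by
  obtain ⟨k, s, r, h⟩ := h
  let e : ((Fin k ⊕ Fin l) → M) ≃ₗ[Λ] (Fin (k + l) → M) :=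
    LinearEquiv.funCongrLeft Λ M finSumFinEquiv.symm
  let e' : ((Fin k ⊕ Fin l) → M) ≃ₗ[Λ] (Fin k → M) × (Fin l → M) :=
    LinearEquiv.sumArrowLequivProdArrow (Fin k) (Fin l) Λ M
  refine ⟨k + l, e.toLinearMap ∘ₗ e'.symm.toLinearMap ∘ₗ s.prodMap LinearMap.id,
    r.prodMap LinearMap.id ∘ₗ e'.toLinearMap ∘ₗ e.symm.toLinearMap, ?_⟩
  have h' : ∀ x, r (s x) = x := fun x => LinearMap.congr_fun h x
  apply LinearMap.ext
  rintro ⟨x, y⟩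
  simp [h']

lemma IsFadd.finite (hM : Module.Finite Λ M) {X : Type} [AddCommGroup X] [Module Λ X]
    (h : IsFadd Λ M X) : Module.Finite Λ X := by
  obtain ⟨k, s, r, h⟩ := h
  exact Module.Finite.of_surjective r fun x => ⟨s x, LinearMap.congr_fun h x⟩

/-- A map from a finitely generated module to a direct sum factors through a finite sum. -/
lemma fin_factor {F : Type} [AddCommGroup F] [Module Λ F] [Module.Finite Λ F] {ι : Type}
    (φ : F →ₗ[Λ] (ι →₀ M)) : ∃ (k : ℕ) (α : F →ₗ[Λ] (Fin k → M))
      (j : (Fin k → M) →ₗ[Λ] (ι →₀ M)), j ∘ₗ α = φ := by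
  classical
  obtain ⟨n, s, hs⟩ := Module.Finite.exists_fin (R := Λ) (M := F)
  let T : Finset ι := Finset.univ.biUnion fun i => (φ (s i)).support
  have hT : ∀ x, φ x ∈ Finsupp.supported M Λ (T : Set ι) := by
    intro x
    have : Submodule.span Λ (Set.range s) ≤ (Finsupp.supported M Λ (T : Set ι)).comap φ := by
      rw [Submodule.span_le]
      rintro _ ⟨i, rfl⟩
      change φ (s i) ∈ Finsupp.supported M Λ (T : Set ι)
      rw [Finsupp.mem_supported]
      intro a ha
      simp only [T, Finset.coe_biUnion, Set.mem_iUnion]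
      exact ⟨i, by simp, ha⟩
    exact this (by rw [hs]; trivial)
  let e := T.equivFin
  refine ⟨T.card, LinearMap.pi fun i => Finsupp.lapply (e.symm i : ι) ∘ₗ φ,
    ∑ i, Finsupp.lsingle (e.symm i : ι) ∘ₗ LinearMap.proj i, ?_⟩
  apply LinearMap.ext
  intro x
  have h1 := (Finsupp.mem_supported _ _).1 (hT x)
  have h2 : φ x = ∑ t ∈ T, Finsupp.single t (φ x t) := by
    conv_lhs => rw [← Finsupp.sum_single (φ x)]
    exact Finsupp.sum_of_support_subset _ (by exact_mod_cast h1) _ (by simp)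
  conv_rhs => rw [h2]
  rw [← Finset.sum_coe_sort T]
  simp only [LinearMap.comp_apply, LinearMap.sum_apply, LinearMap.proj_apply, LinearMap.pi_apply,
    Finsupp.lsingle_apply, Finsupp.lapply_apply]
  exact e.symm.sum_comp (fun t : T => Finsupp.single (t : ι) (φ x t))

lemma IsAdd.isFadd {X : Type} [AddCommGroup X] [Module Λ X] (hX : Module.Finite Λ X)
    (h : IsAdd Λ M X) : IsFadd Λ M X := by
  obtain ⟨ι, s, r, h⟩ := h
  obtain ⟨k, α, j, rfl⟩ := fin_factor s
  exact ⟨k, α, r ∘ₗ j, h⟩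

/-- Maps from objects of `Add M` lift along `Hom(M,-)`-surjections. -/
lemma lift_isAdd {N E X : Type} [AddCommGroup N] [Module Λ N] [AddCommGroup E] [Module Λ E]
    [AddCommGroup X] [Module Λ X] (hN : IsAdd Λ M N) (p : E →ₗ[Λ] X)
    (hp : ∀ g : M →ₗ[Λ] X, ∃ h : M →ₗ[Λ] E, p ∘ₗ h = g) (f : N →ₗ[Λ] X) :
    ∃ h : N →ₗ[Λ] E, p ∘ₗ h = f := by
  obtain ⟨ι, s, r, hsr⟩ := hN
  choose h hh using fun i : ι => hp ((f ∘ₗ r) ∘ₗ Finsupp.lsingle i)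
  have h1 : p ∘ₗ Finsupp.lsum ℕ h = f ∘ₗ r := by
    ext i m
    simpa using LinearMap.congr_fun (hh i) m
  refine ⟨Finsupp.lsum ℕ h ∘ₗ s, ?_⟩
  rw [← LinearMap.comp_assoc, h1, LinearMap.comp_assoc, hsr, LinearMap.comp_id]

lemma lift_of_range_le {F K N : Type} [AddCommGroup F] [Module Λ F] [AddCommGroup K] [Module Λ K]
    [AddCommGroup N] [Module Λ N] (i : K →ₗ[Λ] N) (hi : Function.Injective i) (f : F →ₗ[Λ] N)
    (h : ∀ x, f x ∈ LinearMap.range i) : ∃ f' : F →ₗ[Λ] K, i ∘ₗ f' = f := by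
  refine ⟨(LinearEquiv.ofInjective i hi).symm.toLinearMap ∘ₗ f.codRestrict _ h, ?_⟩
  ext x
  have := (LinearEquiv.ofInjective i hi).apply_symm_apply (f.codRestrict _ h x)
  exact congr_arg Subtype.val this

/-- Right `Add M` approximation. -/
noncomputable def apx (Λ : Type) [Ring Λ] (M X : Type) [AddCommGroup M] [Module Λ M]
    [AddCommGroup X] [Module Λ X] : ((M →ₗ[Λ] X) →₀ M) →ₗ[Λ] X :=
  Finsupp.lsum ℕ fun g => g

lemma apx_lift {X : Type} [AddCommGroup X] [Module Λ X] (g : M →ₗ[Λ] X) :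
    ∃ h : M →ₗ[Λ] ((M →ₗ[Λ] X) →₀ M), apx Λ M X ∘ₗ h = g :=
  ⟨Finsupp.lsingle g, by ext; simp [apx]⟩

lemma surj_of_lift (hgen : IsGen Λ M) {E X : Type} [AddCommGroup E] [Module Λ E]
    [AddCommGroup X] [Module Λ X] (p : E →ₗ[Λ] X)
    (hp : ∀ g : M →ₗ[Λ] X, ∃ h : M →ₗ[Λ] E, p ∘ₗ h = g) : Function.Surjective p := by
  intro x
  obtain ⟨k, u, v, huv⟩ := hgen
  choose h hh using fun i => hp (LinearMap.toSpanSingleton Λ X x ∘ₗ v i)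
  refine ⟨∑ i, h i (u i), ?_⟩
  have h2 : ∀ i, p (h i (u i)) = v i (u i) • x := fun i => LinearMap.congr_fun (hh i) (u i)
  simp [h2, ← Finset.sum_smul, huv]

lemma isAdd_of_mflat (hG : Good Λ M) (hgen : IsGen Λ M) {X : Type} [AddCommGroup X] [Module Λ X]
    (hX : MFlat Λ M X) : IsAdd Λ M X := by
  have := hG.fin
  obtain ⟨s, hs⟩ := exists_section_of_mflat hG.semi hgen hX (apx Λ M X) apx_lift
  exact ⟨_, s, apx Λ M X, hs⟩

section RedProd

variable {ι : Type} (N : ι → Type) [∀ i, AddCommGroup (N i)] [∀ i, Module Λ (N i)]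

lemma mflat_pi (hG : Good Λ M) (hN : ∀ i, IsFadd Λ M (N i)) : MFlat Λ M (∀ i, N i) := by
  intro F _ _ hF φ
  obtain ⟨k, g, hg⟩ := hG.left F hF
  have key : ∀ i, ∃ c : (Fin k → M) →ₗ[Λ] N i, c ∘ₗ g = LinearMap.proj i ∘ₗ φ := by
    intro i
    obtain ⟨l, s, r, h⟩ := hN i
    choose c hc using fun j => hg (LinearMap.proj j ∘ₗ s ∘ₗ LinearMap.proj i ∘ₗ φ)
    refine ⟨r ∘ₗ LinearMap.pi c, ?_⟩
    have h1 : LinearMap.pi c ∘ₗ g = s ∘ₗ LinearMap.proj i ∘ₗ φ := by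
      ext x j
      exact LinearMap.congr_fun (hc j) x
    rw [LinearMap.comp_assoc, h1, ← LinearMap.comp_assoc, h, LinearMap.id_comp]
  choose c hc using key
  refine ⟨k, g, LinearMap.pi c, ?_⟩
  ext x i
  exact (LinearMap.congr_fun (hc i) x).symm

/-- Families vanishing eventually along a filter. -/
def evz (Λ : Type) [Ring Λ] {ι : Type} (l : Filter ι) (N : ι → Type) [∀ i, AddCommGroup (N i)]
    [∀ i, Module Λ (N i)] : Submodule Λ (∀ i, N i) where
  carrier := {f | ∀ᶠ i in l, f i = 0}
  zero_mem' := by simp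
  add_mem' := by
    intro f g hf hg
    filter_upwards [hf, hg] with i h1 h2
    simp [h1, h2]
  smul_mem' := by
    intro c f hf
    filter_upwards [hf] with i h1
    simp [h1]

lemma mem_evz {l : Filter ι} {f : ∀ i, N i} : f ∈ evz Λ l N ↔ ∀ᶠ i in l, f i = 0 := Iff.rfl

lemma evz_lift (hnoeth : IsNoetherianRing Λ) (l : Filter ι) {F : Type} [AddCommGroup F]
    [Module Λ F] (hF : Module.Finite Λ F) (φ : F →ₗ[Λ] ((∀ i, N i) ⧸ evz Λ l N)) :
    ∃ ψ : F →ₗ[Λ] (∀ i, N i), (evz Λ l N).mkQ ∘ₗ ψ = φ := by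
  classical
  obtain ⟨a, π, hπ⟩ := Module.Finite.exists_fin' Λ F
  obtain ⟨ψ, hψ⟩ := Module.projective_lifting_property (evz Λ l N).mkQ (φ ∘ₗ π)
    (Submodule.mkQ_surjective _)
  have hK : (LinearMap.ker π).FG := IsNoetherian.noetherian _
  have hev : ∀ᶠ i in l, ∀ z ∈ LinearMap.ker π, ψ z i = 0 := by
    obtain ⟨T, hT⟩ := hK
    have h1 : ∀ᶠ i in l, ∀ z ∈ T, ψ z i = 0 := by
      rw [Filter.eventually_all_finset]
      intro z hz
      have hz' : z ∈ LinearMap.ker π := hT ▸ Submodule.subset_span hz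
      have h2 : (evz Λ l N).mkQ (ψ z) = 0 := by
        rw [← LinearMap.comp_apply, hψ, LinearMap.comp_apply, LinearMap.mem_ker.1 hz', map_zero]
      rw [Submodule.mkQ_apply, Submodule.Quotient.mk_eq_zero] at h2
      exact h2
    filter_upwards [h1] with i hi z hz
    rw [← hT] at hz
    have : Submodule.span Λ (T : Set (Fin a → Λ)) ≤ LinearMap.ker (LinearMap.proj i ∘ₗ ψ) := by
      rw [Submodule.span_le]
      exact fun z hz => hi z hz
    exact this hz
  let P : ι → Prop := fun i => ∀ z ∈ LinearMap.ker π, ψ z i = 0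
  let psiA : (Fin a → Λ) →ₗ[Λ] (∀ i, N i) :=
    LinearMap.pi fun i => if P i then LinearMap.proj i ∘ₗ ψ else 0
  have hker : LinearMap.ker π ≤ LinearMap.ker psiA := by
    intro z hz
    rw [LinearMap.mem_ker]
    ext i
    by_cases h : P i
    · simpa [psiA, h] using h z hz
    · simp [psiA, h]
  refine ⟨(LinearMap.ker π).liftQ psiA hker ∘ₗ
    (LinearMap.quotKerEquivOfSurjective π hπ).symm.toLinearMap, ?_⟩
  apply LinearMap.ext
  intro x
  obtain ⟨y, rfl⟩ := hπ x
  have h3 : (LinearMap.quotKerEquivOfSurjective π hπ).symm (π y) = (LinearMap.ker π).mkQ y := by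
    rw [LinearEquiv.symm_apply_eq]; rfl
  simp only [LinearMap.comp_apply, LinearEquiv.coe_coe, h3]
  rw [← LinearMap.comp_apply φ π, ← hψ]
  simp only [Submodule.mkQ_apply, Submodule.liftQ_apply, LinearMap.comp_apply]
  rw [Submodule.Quotient.eq, mem_evz]
  filter_upwards [hev] with i hi
  have : P i := hi
  simp [psiA, this]

lemma mflat_redprod (hG : Good Λ M) (hN : ∀ i, IsFadd Λ M (N i)) (l : Filter ι) :
    MFlat Λ M ((∀ i, N i) ⧸ evz Λ l N) := by
  intro F _ _ hF φ
  obtain ⟨ψ, rfl⟩ := evz_lift N hG.noeth l hF φ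
  obtain ⟨k, α, β, rfl⟩ := mflat_pi N hG hN F hF ψ
  exact ⟨k, α, (evz Λ l N).mkQ ∘ₗ β, rfl⟩

end RedProd

/-- `M^(ι) → M^ι` splits. -/
lemma exists_retraction (hG : Good Λ M) (hgen : IsGen Λ M) (ι : Type) :
    ∃ r : (ι → M) →ₗ[Λ] (ι →₀ M), ∀ f : ι →₀ M, r (fun i => f i) = f := by
  have := hG.fin
  let Z := evz Λ (Filter.cofinite : Filter ι) (fun _ => M)
  obtain ⟨s, hs⟩ := exists_section_of_mflat hG.semi hgen
    (mflat_redprod (fun _ : ι => M) hG (fun _ => IsFadd.self) Filter.cofinite) Z.mkQ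
    (fun g => evz_lift (fun _ : ι => M) hG.noeth Filter.cofinite hG.fin g)
  let i : (ι →₀ M) →ₗ[Λ] (ι → M) := Finsupp.lcoeFun
  have hi : Function.Injective i := DFunLike.coe_injective
  obtain ⟨r, hr⟩ := lift_of_range_le i hi (LinearMap.id - s ∘ₗ Z.mkQ) (by
    intro x
    have h1 : Z.mkQ ((LinearMap.id - s ∘ₗ Z.mkQ : (ι → M) →ₗ[Λ] (ι → M)) x) = 0 := by
      have := LinearMap.congr_fun hs (Z.mkQ x)
      simp only [LinearMap.sub_apply, LinearMap.comp_apply, map_sub, LinearMap.id_apply] at this ⊢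
      rw [this, sub_self]
    rw [Submodule.mkQ_apply, Submodule.Quotient.mk_eq_zero, mem_evz, Filter.eventually_cofinite] at h1
    exact ⟨Finsupp.ofSupportFinite _ h1, rfl⟩)
  refine ⟨r, fun f => hi ?_⟩
  have h2 := LinearMap.congr_fun hr (fun i => f i)
  have h3 : Z.mkQ (fun i => f i) = 0 := by
    rw [Submodule.mkQ_apply, Submodule.Quotient.mk_eq_zero, mem_evz, Filter.eventually_cofinite]
    exact f.hasFiniteSupport
  simp only [LinearMap.sub_apply, LinearMap.comp_apply, LinearMap.id_apply, h3, map_zero,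
    sub_zero] at h2
  exact h2

/-- Left `Add M` approximations. -/
lemma exists_left_apx (hG : Good Λ M) (hgen : IsGen Λ M) (A : Type) [AddCommGroup A]
    [Module Λ A] : ∃ (N : Type) (_ : AddCommGroup N) (_ : Module Λ N) (_ : IsAdd Λ M N)
      (f : A →ₗ[Λ] N), ∀ (N' : Type) [AddCommGroup N'] [Module Λ N'], IsAdd Λ M N' →
        ∀ g : A →ₗ[Λ] N', ∃ h : N →ₗ[Λ] N', h ∘ₗ f = g := by
  refine ⟨(A →ₗ[Λ] M) → M, inferInstance, inferInstance,
    isAdd_of_mflat hG hgen (mflat_pi _ hG fun _ => IsFadd.self), LinearMap.pi fun g => g, ?_⟩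
  intro N' _ _ hN' g
  obtain ⟨ι, s, r, hsr⟩ := hN'
  obtain ⟨ρ, hρ⟩ := exists_retraction hG hgen ι
  let h : ((A →ₗ[Λ] M) → M) →ₗ[Λ] (ι → M) :=
    LinearMap.pi fun i => LinearMap.proj (Finsupp.lapply i ∘ₗ s ∘ₗ g)
  refine ⟨r ∘ₗ ρ ∘ₗ h, ?_⟩
  ext x
  have h1 : h (fun g => g x) = fun i => s (g x) i := rfl
  have h2 := LinearMap.congr_fun hsr (g x)
  simp only [LinearMap.comp_apply]
  change r (ρ (h (fun g => g x))) = _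
  rw [h1, hρ]
  exact h2

/-- Every module embeds in an object of `Add M`. -/
lemma exists_embedding (hG : Good Λ M) (hgen : IsGen Λ M)
    (hcog : ∀ (F : Type) [AddCommGroup F] [Module Λ F], Module.Finite Λ F →
      ∃ (k : ℕ) (f : F →ₗ[Λ] (Fin k → M)), Function.Injective f)
    (A : Type) [AddCommGroup A] [Module Λ A] :
    ∃ (N : Type) (_ : AddCommGroup N) (_ : Module Λ N) (_ : IsAdd Λ M N)
      (f : A →ₗ[Λ] N), Function.Injective f := by
  classical
  let S : Finset A → Submodule Λ A := fun T => Submodule.span Λ (T : Set A)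
  have hS : ∀ a : A, ∀ᶠ T in (Filter.atTop : Filter (Finset A)), a ∈ S T := fun a => by
    filter_upwards [Filter.eventually_ge_atTop {a}] with T hT
    exact Submodule.subset_span (by simpa using hT)
  choose k f hf using fun T : Finset A => hcog (S T) (Module.Finite.span_finset Λ T)
  let N : Finset A → Type := fun T => Fin (k T) → M
  let Z := evz Λ (Filter.atTop : Filter (Finset A)) N
  let e : A → ∀ T, N T := fun a T => if h : a ∈ S T then f T ⟨a, h⟩ else 0
  refine ⟨(∀ T, N T) ⧸ Z, inferInstance, inferInstance, isAdd_of_mflat hG hgen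
    (mflat_redprod N hG (fun T => IsFadd.pow _) Filter.atTop), ⟨⟨fun a => Z.mkQ (e a), ?_⟩, ?_⟩, ?_⟩
  · intro a b
    rw [← map_add, Submodule.mkQ_apply, Submodule.mkQ_apply, Submodule.Quotient.eq, mem_evz]
    filter_upwards [hS a, hS b] with T ha hb
    have hab : a + b ∈ S T := add_mem ha hb
    simp only [e, Pi.sub_apply, Pi.add_apply, ha, hb, hab, dif_pos]
    rw [← map_add, sub_eq_zero]
    rfl
  · intro c a
    simp only [RingHom.id_apply]
    rw [← map_smul, Submodule.mkQ_apply, Submodule.mkQ_apply, Submodule.Quotient.eq, mem_evz]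
    filter_upwards [hS a] with T ha
    have hab : c • a ∈ S T := (S T).smul_mem c ha
    simp only [e, Pi.sub_apply, Pi.smul_apply, ha, hab, dif_pos]
    rw [← map_smul, sub_eq_zero]
    rfl
  · rw [injective_iff_map_eq_zero]
    intro a ha
    change Z.mkQ (e a) = 0 at ha
    rw [Submodule.mkQ_apply, Submodule.Quotient.mk_eq_zero, mem_evz] at ha
    obtain ⟨T, h1, h2⟩ := (ha.and (hS a)).exists
    simp only [e, h2, dif_pos] at h1
    have := hf T (h1.trans (map_zero (f T)).symm)
    simpa using this

end AddPart
section SyzPart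

variable {Λ : Type} [Ring Λ] {M : Type} [AddCommGroup M] [Module Λ M]

/-- `C` has an `Hom(M,-)`-exact resolution of length `m` by objects of `add M`. -/
def ResF (Λ : Type) [Ring Λ] (M : Type) [AddCommGroup M] [Module Λ M] :
    ℕ → ∀ (C : Type) [AddCommGroup C] [Module Λ C], Prop
  | 0, C, _, _ => IsFadd Λ M C
  | m + 1, C, _, _ => ∃ (N K : Type) (_ : AddCommGroup N) (_ : Module Λ N) (_ : AddCommGroup K)
      (_ : Module Λ K) (i : K →ₗ[Λ] N) (g : N →ₗ[Λ] C), IsFadd Λ M N ∧ Function.Injective i ∧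
        LinearMap.range i = LinearMap.ker g ∧
        (∀ f : M →ₗ[Λ] C, ∃ h : M →ₗ[Λ] N, g ∘ₗ h = f) ∧ ResF Λ M m K

lemma ResF.prod_pow (m : ℕ) {C : Type} [AddCommGroup C] [Module Λ C] (h : ResF Λ M m C) (l : ℕ) :
    ResF Λ M m (C × (Fin l → M)) := by
  cases m with
  | zero => exact IsFadd.prod_pow h l
  | succ m =>
    obtain ⟨N, K, _, _, _, _, i, g, hN, hi, hig, hg, hK⟩ := h
    refine ⟨N × (Fin l → M), K, inferInstance, inferInstance, inferInstance, inferInstance,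
      LinearMap.inl Λ N _ ∘ₗ i, g.prodMap LinearMap.id, hN.prod_pow l,
      LinearMap.inl_injective.comp hi, ?_, ?_, hK⟩
    · ext ⟨x, y⟩
      constructor
      · rintro ⟨z, hz⟩
        have h1 : i z = x := congr_arg Prod.fst hz
        have h2 : 0 = y := congr_arg Prod.snd hz
        have h3 : x ∈ LinearMap.ker g := hig ▸ ⟨z, h1⟩
        subst h2
        simpa using h3
      · intro hx
        have h1 : g x = 0 := congr_arg Prod.fst hx
        have h2 : y = 0 := congr_arg Prod.snd hx
        have h3 : x ∈ LinearMap.range i := hig ▸ h1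
        obtain ⟨z, rfl⟩ := h3
        subst h2
        exact ⟨z, rfl⟩
    · intro f
      obtain ⟨h, hh⟩ := hg (LinearMap.fst Λ _ _ ∘ₗ f)
      refine ⟨h.prod (LinearMap.snd Λ _ _ ∘ₗ f), ?_⟩
      apply LinearMap.ext
      intro x
      have := LinearMap.congr_fun hh x
      exact Prod.ext this rfl

/-- Every map from a finitely generated module factors through one with a resolution of length
`m`. -/
def FD (Λ : Type) [Ring Λ] (M : Type) [AddCommGroup M] [Module Λ M] (m : ℕ) (X : Type)
    [AddCommGroup X] [Module Λ X] : Prop :=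
  ∀ (F : Type) [AddCommGroup F] [Module Λ F], Module.Finite Λ F → ∀ φ : F →ₗ[Λ] X,
    ∃ (C : Type) (_ : AddCommGroup C) (_ : Module Λ C) (a : F →ₗ[Λ] C) (b : C →ₗ[Λ] X),
      ResF Λ M m C ∧ φ = b ∘ₗ a

lemma FD.mflat {X : Type} [AddCommGroup X] [Module Λ X] (h : FD Λ M 0 X) : MFlat Λ M X := by
  intro F _ _ hF φ
  obtain ⟨C, _, _, a, b, hC, rfl⟩ := h F hF φ
  obtain ⟨k, s, r, hsr⟩ := hC
  refine ⟨k, s ∘ₗ a, b ∘ₗ r, ?_⟩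
  rw [LinearMap.comp_assoc, ← LinearMap.comp_assoc a, hsr, LinearMap.id_comp]

lemma FD.step (hM : Module.Finite Λ M) {m : ℕ} {X : Type} [AddCommGroup X] [Module Λ X]
    (h : FD Λ M (m + 1) X) :
    FD Λ M m (LinearMap.ker (apx Λ M X)) := by
  set p := apx Λ M X with hpdef
  intro F _ _ hF φ
  obtain ⟨k, phiA, j, hj⟩ := fin_factor ((LinearMap.ker p).subtype ∘ₗ φ)
  have hjx : ∀ x, j (phiA x) = φ x := fun x => LinearMap.congr_fun hj x
  have hk : LinearMap.range phiA ≤ LinearMap.ker (p ∘ₗ j) := by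
    rintro _ ⟨x, rfl⟩
    rw [LinearMap.mem_ker, LinearMap.comp_apply, hjx]
    exact (φ x).2
  obtain ⟨C, _, _, a, b, hC, hab⟩ := h ((Fin k → M) ⧸ LinearMap.range phiA) inferInstance
    ((LinearMap.range phiA).liftQ (p ∘ₗ j) hk)
  obtain ⟨N, K, _, _, _, _, i, g, hN, hi, hig, hg, hK⟩ := hC
  obtain ⟨q, hq⟩ := lift_isAdd hN.isAdd p apx_lift (b ∘ₗ g)
  obtain ⟨t, ht⟩ := lift_isAdd (IsFadd.pow (Λ := Λ) (M := M) k).isAdd g hg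
    (a ∘ₗ (LinearMap.range phiA).mkQ)
  have hqx : ∀ x, p (q x) = b (g x) := fun x => LinearMap.congr_fun hq x
  have htx : ∀ x, g (t x) = a ((LinearMap.range phiA).mkQ x) := fun x => LinearMap.congr_fun ht x
  have habx : ∀ x, p (j x) = b (a ((LinearMap.range phiA).mkQ x)) := fun x =>
    LinearMap.congr_fun hab ((LinearMap.range phiA).mkQ x)
  obtain ⟨α, hα⟩ := lift_of_range_le i hi (t ∘ₗ phiA) (by
    intro x
    rw [hig, LinearMap.mem_ker, LinearMap.comp_apply, htx]
    rw [show (LinearMap.range phiA).mkQ (phiA x) = 0 by simp, map_zero])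
  have hαx : ∀ x, i (α x) = t (phiA x) := fun x => LinearMap.congr_fun hα x
  let d1 : K →ₗ[Λ] LinearMap.ker p := (q ∘ₗ i).codRestrict _ (by
    intro x
    rw [LinearMap.mem_ker, LinearMap.comp_apply, hqx]
    have : i x ∈ LinearMap.ker g := hig ▸ ⟨x, rfl⟩
    rw [LinearMap.mem_ker.1 this, map_zero])
  let d2 : (Fin k → M) →ₗ[Λ] LinearMap.ker p := (j - q ∘ₗ t).codRestrict _ (by
    intro x
    rw [LinearMap.mem_ker, LinearMap.sub_apply, map_sub, LinearMap.comp_apply, hqx, htx, habx,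
      sub_self])
  refine ⟨K × (Fin k → M), inferInstance, inferInstance, α.prod phiA, d1.coprod d2,
    hK.prod_pow m k, ?_⟩
  ext1 x
  apply Subtype.ext
  simp only [LinearMap.comp_apply, LinearMap.prod_apply, Function.prod, LinearMap.coprod_apply,
    Submodule.coe_add, d1, d2, LinearMap.codRestrict_apply, LinearMap.sub_apply, hαx, hjx]
  abel

/-- `X` has a resolution of length `m` by objects of `Add M`. -/
def ResB (Λ : Type) [Ring Λ] (M : Type) [AddCommGroup M] [Module Λ M] :
    ℕ → ∀ (C : Type) [AddCommGroup C] [Module Λ C], Prop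
  | 0, C, _, _ => IsAdd Λ M C
  | m + 1, C, _, _ => ∃ (N K : Type) (_ : AddCommGroup N) (_ : Module Λ N) (_ : AddCommGroup K)
      (_ : Module Λ K) (i : K →ₗ[Λ] N) (g : N →ₗ[Λ] C), IsAdd Λ M N ∧ Function.Injective i ∧
        LinearMap.range i = LinearMap.ker g ∧ Function.Surjective g ∧ ResB Λ M m K

lemma FD.resB (hG : Good Λ M) (hgen : IsGen Λ M) (m : ℕ) : ∀ (X : Type) [AddCommGroup X]
    [Module Λ X], FD Λ M m X → ResB Λ M m X := by
  induction m with
  | zero => exact fun X _ _ h => isAdd_of_mflat hG hgen h.mflat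
  | succ m ih =>
    intro X _ _ h
    exact ⟨_, LinearMap.ker (apx Λ M X), inferInstance, inferInstance, inferInstance,
      inferInstance, (LinearMap.ker (apx Λ M X)).subtype, apx Λ M X, IsAdd.finsupp _,
      Subtype.val_injective, Submodule.range_subtype _, surj_of_lift hgen _ apx_lift,
      ih _ (h.step hG.fin)⟩

end SyzPart

/-- Vanishing of `Ext^i(X, Y)`, unbundled, in terms of the derived-category `Ext`. -/
def EZ (Λ : Type) [Ring Λ] (i : ℕ) (X Y : Type) [AddCommGroup X] [Module Λ X] [AddCommGroup Y]
    [Module Λ Y] : Prop :=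
  ∀ e : Abelian.Ext (ModuleCat.of Λ X) (ModuleCat.of Λ Y) i, e = 0

lemma extZero_iff {i : ℕ} (hi : 0 < i) (X Y : ModuleCat.{0} Λ) :
    extZero i X Y ↔ EZ Λ i X Y := by
  obtain ⟨i, rfl⟩ : ∃ j, i = j + 1 := ⟨i - 1, by omega⟩
  let P := ProjectiveResolution.of X
  have key : extZero (i + 1) X Y ↔ ∀ f : P.complex.X (i + 1) ⟶ Y,
      P.complex.d (i + 2) (i + 1) ≫ f = 0 → ∃ g : P.complex.X i ⟶ Y,
        P.complex.d (i + 1) i ≫ g = f := by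
    unfold extZero
    rw [(P.isoExt (R := ℤ) (i + 1) Y).isZero_iff, ← HomologicalComplex.exactAt_iff_isZero_homology,
      HomologicalComplex.exactAt_iff' _ i (i + 1) (i + 2) (by simp) (by simp),
      ShortComplex.moduleCat_exact_iff]
    rfl
  rw [key]
  constructor
  · intro h e
    obtain ⟨f, hf, rfl⟩ := P.extMk_surjective (Y := Y) e (i + 2) rfl
    exact (P.extMk_eq_zero_iff f (i + 2) rfl hf i rfl).2 (h f hf)
  · intro h f hf
    exact (P.extMk_eq_zero_iff f (i + 2) rfl hf i rfl).1 (h _)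

section ez

open Abelian

variable {X Y A B C : Type} [AddCommGroup X] [Module Λ X] [AddCommGroup Y] [Module Λ Y]
  [AddCommGroup A] [Module Λ A] [AddCommGroup B] [Module Λ B] [AddCommGroup C] [Module Λ C]

lemma EZ.summand_left {i : ℕ} (h : EZ Λ i X Y) (s : A →ₗ[Λ] X) (r : X →ₗ[Λ] A)
    (hrs : r ∘ₗ s = LinearMap.id) : EZ Λ i A Y := by
  intro e
  have h1 : (Ext.mk₀ (ModuleCat.ofHom r)).comp e (zero_add i) = 0 := h _
  have h2 := congrArg (fun z => (Ext.mk₀ (ModuleCat.ofHom s)).comp z (zero_add i)) h1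
  have h3 : ModuleCat.ofHom s ≫ ModuleCat.ofHom r = 𝟙 (ModuleCat.of Λ A) := by
    rw [← ModuleCat.ofHom_comp, hrs]; rfl
  simpa only [Ext.mk₀_comp_mk₀_assoc, h3, Ext.mk₀_id_comp, Ext.comp_zero] using h2

lemma EZ.summand_right {i : ℕ} (h : EZ Λ i X Y) (s : A →ₗ[Λ] Y) (r : Y →ₗ[Λ] A)
    (hrs : r ∘ₗ s = LinearMap.id) : EZ Λ i X A := by
  intro e
  have h1 : e.comp (Ext.mk₀ (ModuleCat.ofHom s)) (add_zero i) = 0 := h _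
  have h2 := congrArg (fun z => z.comp (Ext.mk₀ (ModuleCat.ofHom r)) (add_zero i)) h1
  have h3 : ModuleCat.ofHom s ≫ ModuleCat.ofHom r = 𝟙 (ModuleCat.of Λ A) := by
    rw [← ModuleCat.ofHom_comp, hrs]; rfl
  simpa only [Ext.comp_assoc_of_third_deg_zero, Ext.mk₀_comp_mk₀, h3, Ext.comp_mk₀_id,
    Ext.zero_comp] using h2

lemma ez_proj (i : ℕ) [Projective (ModuleCat.of Λ X)] : EZ Λ (i + 1) X Y :=
  fun e => Ext.eq_zero_of_projective e

lemma ez_inj (i : ℕ) [Injective (ModuleCat.of Λ Y)] : EZ Λ (i + 1) X Y :=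
  fun e => Ext.eq_zero_of_injective e

/-- Short exact sequences of linear maps. -/
structure SES (i : A →ₗ[Λ] B) (g : B →ₗ[Λ] C) : Prop where
  inj : Function.Injective i
  ex : LinearMap.range i = LinearMap.ker g
  surj : Function.Surjective g

variable {i : A →ₗ[Λ] B} {g : B →ₗ[Λ] C}

lemma SES.zero (h : SES i g) : g ∘ₗ i = 0 := by
  ext x
  have : i x ∈ LinearMap.ker g := h.ex ▸ ⟨x, rfl⟩
  simpa using this

/-- The associated short complex. -/
abbrev SES.sc (h : SES i g) : ShortComplex (ModuleCat.{0} Λ) :=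
  ShortComplex.mk (ModuleCat.ofHom i) (ModuleCat.ofHom g) (by
    rw [← ModuleCat.ofHom_comp, h.zero]; rfl)

lemma SES.se (h : SES i g) : h.sc.ShortExact where
  exact := by
    rw [ShortComplex.moduleCat_exact_iff]
    intro x hx
    have : x ∈ LinearMap.range i := by rw [h.ex]; exact hx
    exact this
  mono_f := (ModuleCat.mono_iff_injective _).2 h.inj
  epi_g := (ModuleCat.epi_iff_surjective _).2 h.surj

lemma SES.c1 (h : SES i g) {n : ℕ} (h1 : EZ Λ n X C) (h2 : EZ Λ (n + 1) X B) :
    EZ Λ (n + 1) X A := by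
  intro e
  obtain ⟨x, hx⟩ := Ext.covariant_sequence_exact₁ (ModuleCat.of Λ X) h.se e (h2 _)
    (rfl : n + 1 = n + 1)
  rw [← hx, show x = 0 from h1 x, Ext.zero_comp]

lemma SES.c2 (h : SES i g) {n : ℕ} (h1 : EZ Λ n X B) (h2 : EZ Λ (n + 1) X A) :
    EZ Λ n X C := by
  intro e
  obtain ⟨x, hx⟩ := Ext.covariant_sequence_exact₃ (ModuleCat.of Λ X) h.se e
    (rfl : n + 1 = n + 1) (h2 _)
  rw [← hx, show x = 0 from h1 x, Ext.zero_comp]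

lemma SES.c0 (h : SES i g) (h1 : ∀ f : X →ₗ[Λ] C, ∃ k : X →ₗ[Λ] B, g ∘ₗ k = f)
    (h2 : EZ Λ 1 X B) : EZ Λ 1 X A := by
  intro e
  obtain ⟨x, hx⟩ := Ext.covariant_sequence_exact₁ (ModuleCat.of Λ X) h.se e (h2 _)
    (rfl : 0 + 1 = 1)
  obtain ⟨f, rfl⟩ := Ext.addEquiv₀.symm.surjective x
  obtain ⟨k, hk⟩ := h1 f.hom
  have h3 : f = ModuleCat.ofHom k ≫ h.sc.g := by
    apply ModuleCat.hom_ext; exact hk.symm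
  rw [← hx, h3, Ext.addEquiv₀_symm_apply, ← Ext.mk₀_comp_mk₀]
  rw [Ext.comp_assoc_of_second_deg_zero, ShortComplex.ShortExact.comp_extClass, Ext.comp_zero]

lemma SES.c0' (h : SES i g) (h2 : EZ Λ 1 X A) (f : X →ₗ[Λ] C) :
    ∃ k : X →ₗ[Λ] B, g ∘ₗ k = f := by
  obtain ⟨x, hx⟩ := Ext.covariant_sequence_exact₃ (ModuleCat.of Λ X) h.se
    (Ext.mk₀ (ModuleCat.ofHom f)) (rfl : 0 + 1 = 1) (h2 _)
  obtain ⟨k, rfl⟩ := Ext.addEquiv₀.symm.surjective x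
  rw [Ext.addEquiv₀_symm_apply, Ext.mk₀_comp_mk₀] at hx
  have := (Ext.mk₀_bijective _ _).1 hx
  exact ⟨k.hom, congrArg ModuleCat.Hom.hom this⟩

lemma SES.d1 (h : SES i g) {n : ℕ} (h1 : EZ Λ n A Y) (h2 : EZ Λ (n + 1) B Y) :
    EZ Λ (n + 1) C Y := by
  intro e
  obtain ⟨x, hx⟩ := Ext.contravariant_sequence_exact₃ h.se (ModuleCat.of Λ Y) e (h2 _)
    (add_comm 1 n)
  rw [← hx, show x = 0 from h1 x, Ext.comp_zero]

lemma SES.d2 (h : SES i g) {n : ℕ} (h1 : EZ Λ n B Y) (h2 : EZ Λ (n + 1) C Y) :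
    EZ Λ n A Y := by
  intro e
  obtain ⟨x, hx⟩ := Ext.contravariant_sequence_exact₁ h.se (ModuleCat.of Λ Y) e
    (add_comm 1 n) (h2 _)
  rw [← hx, show x = 0 from h1 x, Ext.comp_zero]

lemma SES.d0 (h : SES i g) (h1 : ∀ f : A →ₗ[Λ] Y, ∃ k : B →ₗ[Λ] Y, k ∘ₗ i = f)
    (h2 : EZ Λ 1 B Y) : EZ Λ 1 C Y := by
  intro e
  obtain ⟨x, hx⟩ := Ext.contravariant_sequence_exact₃ h.se (ModuleCat.of Λ Y) e (h2 _)
    (rfl : 1 + 0 = 1)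
  obtain ⟨f, rfl⟩ := Ext.addEquiv₀.symm.surjective x
  obtain ⟨k, hk⟩ := h1 f.hom
  have h3 : f = h.sc.f ≫ ModuleCat.ofHom k := by
    apply ModuleCat.hom_ext; exact hk.symm
  rw [← hx, h3, Ext.addEquiv₀_symm_apply, ← Ext.mk₀_comp_mk₀]
  rw [← Ext.comp_assoc_of_second_deg_zero, ShortComplex.ShortExact.extClass_comp, Ext.zero_comp]

lemma SES.d0' (h : SES i g) (h2 : EZ Λ 1 C Y) (f : A →ₗ[Λ] Y) :
    ∃ k : B →ₗ[Λ] Y, k ∘ₗ i = f := by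
  obtain ⟨x, hx⟩ := Ext.contravariant_sequence_exact₁ h.se (ModuleCat.of Λ Y)
    (Ext.mk₀ (ModuleCat.ofHom f)) (rfl : 1 + 0 = 1) (h2 _)
  obtain ⟨k, rfl⟩ := Ext.addEquiv₀.symm.surjective x
  rw [Ext.addEquiv₀_symm_apply, Ext.mk₀_comp_mk₀] at hx
  have := (Ext.mk₀_bijective _ _).1 hx
  exact ⟨k.hom, congrArg ModuleCat.Hom.hom this⟩

lemma ses_ker (g : B →ₗ[Λ] C) (hg : Function.Surjective g) : SES (LinearMap.ker g).subtype g :=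
  ⟨Subtype.val_injective, Submodule.range_subtype _, hg⟩

lemma ses_coker (i : A →ₗ[Λ] B) (hi : Function.Injective i) : SES i (LinearMap.range i).mkQ :=
  ⟨hi, (Submodule.ker_mkQ _).symm, Submodule.mkQ_surjective _⟩

lemma exists_inj (Y : Type) [AddCommGroup Y] [Module Λ Y] :
    ∃ (I : ModuleCat.{0} Λ) (_ : Injective (ModuleCat.of Λ I)) (f : Y →ₗ[Λ] I),
      Function.Injective f :=
  ⟨Injective.under (ModuleCat.of Λ Y), inferInstanceAs (Injective (Injective.under _)),
    (Injective.ι (ModuleCat.of Λ Y)).hom, (ModuleCat.mono_iff_injective _).1 inferInstance⟩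

lemma EZ.finsupp_left (ι : Type) (n : ℕ) : ∀ (Y : Type) [AddCommGroup Y] [Module Λ Y],
    EZ Λ (n + 1) X Y → EZ Λ (n + 1) (ι →₀ X) Y := by
  induction n with
  | zero =>
    intro Y _ _ h
    obtain ⟨I, _, f, hf⟩ := exists_inj (Λ := Λ) Y
    refine (ses_coker f hf).c0 (fun u => ?_) (ez_inj 0)
    choose k hk using fun a : ι => (ses_coker f hf).c0' h (u ∘ₗ Finsupp.lsingle a)
    refine ⟨Finsupp.lsum ℕ k, ?_⟩
    ext a x
    have := LinearMap.congr_fun (hk a) x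
    simpa using this
  | succ n ih =>
    intro Y _ _ h
    obtain ⟨I, _, f, hf⟩ := exists_inj (Λ := Λ) Y
    exact (ses_coker f hf).c1 (ih _ ((ses_coker f hf).c2 (ez_inj n) h)) (ez_inj (n + 1))

lemma EZ.finsupp_right [IsNoetherianRing Λ] (ι : Type) (n : ℕ) :
    ∀ (F : Type) [AddCommGroup F] [Module Λ F] [Module.Finite Λ F],
    EZ Λ (n + 1) F Y → EZ Λ (n + 1) F (ι →₀ Y) := by
  have hP (k : ℕ) : Projective (ModuleCat.of Λ (Fin k → Λ)) :=
    ModuleCat.projective_of_free (Pi.basisFun Λ (Fin k))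
  induction n with
  | zero =>
    intro F _ _ _ h
    obtain ⟨k, p, hp⟩ := Module.Finite.exists_fin' Λ F
    have := hP k
    refine (ses_ker p hp).d0 (fun u => ?_) (ez_proj 0)
    obtain ⟨m, phiA, j, hj⟩ := fin_factor u
    choose v hv using fun a : Fin m => (ses_ker p hp).d0' h (LinearMap.proj a ∘ₗ phiA)
    refine ⟨j ∘ₗ LinearMap.pi v, ?_⟩
    rw [← hj, LinearMap.comp_assoc]
    congr 1
    ext x a
    exact LinearMap.congr_fun (hv a) x
  | succ n ih =>
    intro F _ _ _ h
    obtain ⟨k, p, hp⟩ := Module.Finite.exists_fin' Λ F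
    have := hP k
    exact (ses_ker p hp).d1 (ih _ ((ses_ker p hp).d2 (ez_proj n) h)) (ez_proj (n + 1))

end ez

section ez2

variable {M X Y : Type} [AddCommGroup M] [Module Λ M] [AddCommGroup X] [Module Λ X]
  [AddCommGroup Y] [Module Λ Y]

lemma IsAdd.ez_left (hX : IsAdd Λ M X) {n : ℕ} (hn : 0 < n) (h : EZ Λ n M Y) : EZ Λ n X Y := by
  obtain ⟨m, rfl⟩ : ∃ j, n = j + 1 := ⟨n - 1, by omega⟩
  obtain ⟨ι, s, r, hrs⟩ := hX
  exact (EZ.finsupp_left ι m Y h).summand_left s r hrs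

lemma IsAdd.ez_right [IsNoetherianRing Λ] [Module.Finite Λ X] (hY : IsAdd Λ M Y) {n : ℕ}
    (hn : 0 < n) (h : EZ Λ n X M) : EZ Λ n X Y := by
  obtain ⟨m, rfl⟩ : ∃ j, n = j + 1 := ⟨n - 1, by omega⟩
  obtain ⟨ι, s, r, hrs⟩ := hY
  exact (EZ.finsupp_right ι m X h).summand_right s r hrs

end ez2

section MainPart

variable {M : Type} [AddCommGroup M] [Module Λ M]

lemma resF_of_ez (hG : Good Λ M) (hgen : IsGen Λ M) {n : ℕ}
    (hself : ∀ i, 0 < i → i < n → EZ Λ i M M)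
    (hR : ∀ (F : Type) [AddCommGroup F] [Module Λ F], Module.Finite Λ F →
      (∀ i, 0 < i → i < n → EZ Λ i M F) → IsFadd Λ M F) (d : ℕ) :
    ∀ (F : Type) [AddCommGroup F] [Module Λ F] (j : ℕ), Module.Finite Λ F → j + d + 1 = n →
      (∀ i, 0 < i → i ≤ j → EZ Λ i M F) → ResF Λ M d F := by
  have := hG.noeth
  have := hG.fin
  induction d with
  | zero =>
    intro F _ _ j hF hj h
    exact hR F hF fun i hi hin => h i hi (by omega)
  | succ d ih =>
    intro F _ _ j hF hj h
    obtain ⟨k, g, hg⟩ := hG.right F hF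
    have hS := ses_ker g (surj_of_lift hgen g hg)
    refine ⟨Fin k → M, LinearMap.ker g, inferInstance, inferInstance, inferInstance,
      inferInstance, (LinearMap.ker g).subtype, g, IsFadd.pow k, hS.inj, hS.ex, hg, ?_⟩
    refine ih _ (j + 1) inferInstance (by omega) fun i hi hij => ?_
    have hMk : EZ Λ i M (Fin k → M) :=
      (IsFadd.pow k).isAdd.ez_right hi (hself i hi (by omega))
    obtain ⟨i, rfl⟩ : ∃ i', i = i' + 1 := ⟨i - 1, by omega⟩
    rcases Nat.eq_zero_or_pos i with rfl | hi'
    · exact hS.c0 hg hMk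
    · exact hS.c1 (h i hi' (by omega)) hMk

/-- Orthogonality inside `Add M`. -/
lemma ez_add (hG : Good Λ M) {n : ℕ} (hself : ∀ i, 0 < i → i < n → EZ Λ i M M)
    {X Y : Type} [AddCommGroup X] [Module Λ X] [AddCommGroup Y] [Module Λ Y]
    (hX : IsAdd Λ M X) (hY : IsAdd Λ M Y) {i : ℕ} (hi : 0 < i) (hin : i < n) : EZ Λ i X Y := by
  have := hG.noeth
  have := hG.fin
  exact hX.ez_left hi (hY.ez_right hi (hself i hi hin))

lemma isAdd_of_resB (hG : Good Λ M) {n : ℕ} (hself : ∀ i, 0 < i → i < n → EZ Λ i M M) (m : ℕ) :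
    ∀ (X : Type) [AddCommGroup X] [Module Λ X], m < n → ResB Λ M m X →
      (∀ i, 0 < i → i ≤ m → ∀ (M' : Type) [AddCommGroup M'] [Module Λ M'], IsAdd Λ M M' →
        EZ Λ i X M') → IsAdd Λ M X := by
  induction m with
  | zero => exact fun X _ _ _ h _ => h
  | succ m ih =>
    intro X _ _ hm hX h
    obtain ⟨N, K, _, _, _, _, i, g, hN, hi, hig, hg, hK⟩ := hX
    have hS : SES i g := ⟨hi, hig, hg⟩
    have hK' : IsAdd Λ M K := by
      refine ih K (by omega) hK fun l hl hlm M' _ _ hM' => ?_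
      exact hS.d2 (ez_add hG hself hN hM' hl (by omega)) (h (l + 1) (by omega) (by omega) M' hM')
    obtain ⟨s, hs⟩ := hS.c0' (h 1 (by omega) (by omega) K hK') LinearMap.id
    exact hN.of_summand s g hs

lemma big_left (hG : Good Λ M) (hgen : IsGen Λ M) {n : ℕ} (hn : 0 < n)
    (hself : ∀ i, 0 < i → i < n → EZ Λ i M M)
    (hR : ∀ (F : Type) [AddCommGroup F] [Module Λ F], Module.Finite Λ F →
      (∀ i, 0 < i → i < n → EZ Λ i M F) → IsFadd Λ M F)
    (X : Type) [AddCommGroup X] [Module Λ X]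
    (h : ∀ i, 0 < i → i < n → ∀ (M' : Type) [AddCommGroup M'] [Module Λ M'], IsAdd Λ M M' →
        EZ Λ i X M') : IsAdd Λ M X := by
  refine isAdd_of_resB hG hself (n - 1) X (by omega) ?_ fun i hi hin M' _ _ hM' =>
    h i hi (by omega) M' hM'
  refine FD.resB hG hgen _ X ?_
  intro F _ _ hF φ
  exact ⟨F, inferInstance, inferInstance, LinearMap.id, φ,
    resF_of_ez hG hgen hself hR (n - 1) F 0 hF (by omega) (fun i hi hi' => by omega), rfl⟩

lemma big_right (hG : Good Λ M) (hgen : IsGen Λ M)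
    (hcog : ∀ (F : Type) [AddCommGroup F] [Module Λ F], Module.Finite Λ F →
      ∃ (k : ℕ) (f : F →ₗ[Λ] (Fin k → M)), Function.Injective f) {n : ℕ} (hn : 0 < n)
    (hself : ∀ i, 0 < i → i < n → EZ Λ i M M)
    (hR : ∀ (F : Type) [AddCommGroup F] [Module Λ F], Module.Finite Λ F →
      (∀ i, 0 < i → i < n → EZ Λ i M F) → IsFadd Λ M F) (d : ℕ) :
    ∀ (X : Type) [AddCommGroup X] [Module Λ X] (j : ℕ), j + d + 1 = n →
    (∀ i, 0 < i → i ≤ j → ∀ (M' : Type) [AddCommGroup M'] [Module Λ M'], IsAdd Λ M M' →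
        EZ Λ i X M') →
    (∀ i, 0 < i → i ≤ d → ∀ (M' : Type) [AddCommGroup M'] [Module Λ M'], IsAdd Λ M M' →
        EZ Λ i M' X) → IsAdd Λ M X := by
  induction d with
  | zero =>
    intro X _ _ j hj h _
    exact big_left hG hgen hn hself hR X fun i hi hin M' _ _ hM' => h i hi (by omega) M' hM'
  | succ d ih =>
    intro X _ _ j hj h h'
    obtain ⟨N, _, _, hN, f, hf⟩ := exists_left_apx hG hgen X
    obtain ⟨N₁, _, _, hN₁, f₁, hf₁⟩ := exists_embedding hG hgen hcog X
    have hinj : Function.Injective f := by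
      obtain ⟨t, ht⟩ := hf N₁ hN₁ f₁
      rw [← ht] at hf₁
      exact Function.Injective.of_comp (f := t) hf₁
    have hS := ses_coker f hinj
    have hC : IsAdd Λ M (N ⧸ LinearMap.range f) := by
      refine ih _ (j + 1) (by omega) (fun i hi hij M' _ _ hM' => ?_)
        (fun i hi hid M' _ _ hM' => ?_)
      · obtain ⟨i, rfl⟩ : ∃ i', i = i' + 1 := ⟨i - 1, by omega⟩
        have hNM := ez_add hG hself hN hM' hi (by omega)
        rcases Nat.eq_zero_or_pos i with rfl | hi'
        · exact hS.d0 (fun u => hf M' hM' u) hNM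
        · exact hS.d1 (h i hi' (by omega) M' hM') hNM
      · exact hS.c2 (ez_add hG hself hM' hN hi (by omega))
          (h' (i + 1) (by omega) (by omega) M' hM')
    obtain ⟨r, hr⟩ := hS.d0' (h' 1 (by omega) (by omega) _ hC) LinearMap.id
    exact hN.of_summand f r hr

end MainPart

section Bridge

lemma mem_AddCl_iff (M N : ModuleCat.{0} Λ) : N ∈ AddCl {M} ↔ IsAdd Λ M N := by
  classical
  constructor
  · rintro ⟨ι, X, hX, s, r, hsr⟩
    obtain rfl : X = fun _ => M := funext hX
    let e := finsuppLEquivDirectSum Λ M ι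
    refine IsAdd.of_summand (IsAdd.finsupp ι) (e.symm.toLinearMap ∘ₗ s.hom)
      (r.hom ∘ₗ e.toLinearMap) ?_
    ext x
    have := LinearMap.congr_fun (congrArg ModuleCat.Hom.hom hsr) x
    simpa using this
  · rintro ⟨ι, s, r, hsr⟩
    let e := finsuppLEquivDirectSum Λ M ι
    refine ⟨ι, fun _ => M, fun _ => rfl, ModuleCat.ofHom (e.toLinearMap ∘ₗ s),
      ModuleCat.ofHom (r ∘ₗ e.symm.toLinearMap), ?_⟩
    ext x
    have := LinearMap.congr_fun hsr x
    simpa using this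

lemma mem_addCl_iff (M N : ModuleCat.{0} Λ) : N ∈ addCl {M} ↔ IsFadd Λ M N := by
  classical
  constructor
  · rintro ⟨k, X, hX, s, r, hsr⟩
    obtain rfl : X = fun _ => M := funext hX
    let e := DirectSum.linearEquivFunOnFintype Λ (Fin k) (fun _ => M)
    refine IsFadd.of_summand (IsFadd.pow k) (e.toLinearMap ∘ₗ s.hom)
      (r.hom ∘ₗ e.symm.toLinearMap) ?_
    ext x
    have := LinearMap.congr_fun (congrArg ModuleCat.Hom.hom hsr) x
    simpa using this
  · rintro ⟨k, s, r, hsr⟩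
    let e := DirectSum.linearEquivFunOnFintype Λ (Fin k) (fun _ => M)
    refine ⟨k, fun _ => M, fun _ => rfl, ModuleCat.ofHom (e.symm.toLinearMap ∘ₗ s),
      ModuleCat.ofHom (r ∘ₗ e.toLinearMap), ?_⟩
    ext x
    have := LinearMap.congr_fun hsr x
    simpa using this

/-- A surjection from a member of `add M` onto `Λ` makes `M` a generator. -/
lemma isGen_of_surj {M N : Type} [AddCommGroup M] [Module Λ M] [AddCommGroup N] [Module Λ N]
    (hN : IsFadd Λ M N) (p : N →ₗ[Λ] Λ) (hp : Function.Surjective p) : IsGen Λ M := by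
  classical
  obtain ⟨k, s, r, hrs⟩ := hN
  obtain ⟨x, hx⟩ := hp 1
  refine ⟨k, s x, fun i => p ∘ₗ r ∘ₗ LinearMap.single Λ (fun _ => M) i, ?_⟩
  have h1 : r (s x) = x := LinearMap.congr_fun hrs x
  have h2 : ∑ i, Pi.single i (s x i) = s x := Finset.univ_sum_single (s x)
  calc _ = ∑ i, p (r (Pi.single i (s x i))) := rfl
    _ = p (r (∑ i, Pi.single i (s x i))) := by rw [map_sum, map_sum]
    _ = 1 := by rw [h2, h1, hx]

lemma inj_pow {M N F : Type} [AddCommGroup M] [Module Λ M] [AddCommGroup N] [Module Λ N]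
    [AddCommGroup F] [Module Λ F] [Module.Finite Λ F]
    (hN : IsAdd Λ M N) (f : F →ₗ[Λ] N) (hf : Function.Injective f) :
    ∃ (k : ℕ) (g : F →ₗ[Λ] (Fin k → M)), Function.Injective g := by
  obtain ⟨ι, s, r, hrs⟩ := hN
  obtain ⟨k, α, j, h⟩ := fin_factor (s ∘ₗ f)
  refine ⟨k, α, fun x y hxy => hf ?_⟩
  have hx := LinearMap.congr_fun h x
  have hy := LinearMap.congr_fun h y
  simp only [LinearMap.comp_apply] at hx hy
  have hr : ∀ z, r (s z) = z := fun z => LinearMap.congr_fun hrs z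
  rw [← hr (f x), ← hr (f y), ← hx, ← hy, hxy]

lemma ext_isFadd {M A B N : Type} [AddCommGroup M] [Module Λ M] [AddCommGroup N] [Module Λ N]
    [AddCommGroup A] [Module Λ A] [AddCommGroup B] [Module Λ B]
    (hN : IsFadd Λ M N) (i : A →ₗ[Λ] B)
    (hi : ∀ g : A →ₗ[Λ] M, ∃ h : B →ₗ[Λ] M, h ∘ₗ i = g) (f : A →ₗ[Λ] N) :
    ∃ h : B →ₗ[Λ] N, h ∘ₗ i = f := by
  obtain ⟨k, s, r, hrs⟩ := hN
  choose v hv using fun a : Fin k => hi (LinearMap.proj a ∘ₗ s ∘ₗ f)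
  refine ⟨r ∘ₗ LinearMap.pi v, ?_⟩
  have h1 : LinearMap.pi v ∘ₗ i = s ∘ₗ f := by
    ext x a
    exact LinearMap.congr_fun (hv a) x
  rw [LinearMap.comp_assoc, h1, ← LinearMap.comp_assoc, hrs, LinearMap.id_comp]

lemma small_of_big (M : ModuleCat.{0} Λ) (hG : Good Λ M) (n : ℕ)
    (h : IsNClusterTilting n Set.univ (AddCl {M})) :
    IsNClusterTilting n (modFG Λ) (addCl {M}) := by
  have := hG.noeth
  have := hG.fin
  have hMm : M ∈ addCl {M} := (mem_addCl_iff M M).2 IsFadd.self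
  have hMM : M ∈ AddCl {M} := (mem_AddCl_iff M M).2 IsFadd.self.isAdd
  have hiff : ∀ X ∈ modFG Λ, (X ∈ addCl {M} ↔ X ∈ AddCl {M}) := fun X hX => by
    rw [mem_addCl_iff, mem_AddCl_iff]
    exact ⟨fun h => h.isAdd, fun h => h.isFadd hX⟩
  have hgen : IsGen Λ M := by
    obtain ⟨N, hN, f, hf⟩ := h.generating (ModuleCat.of Λ Λ) trivial
    rw [mem_AddCl_iff] at hN
    obtain ⟨ι, s, r, hrs⟩ := hN
    obtain ⟨x, hx⟩ := hf 1
    obtain ⟨k, α, j, hαj⟩ := fin_factor (s ∘ₗ LinearMap.toSpanSingleton Λ N x)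
    refine isGen_of_surj (IsFadd.pow k) (f.hom ∘ₗ r ∘ₗ j) ?_
    intro c
    refine ⟨α c, ?_⟩
    have h1 : j (α c) = s (c • x) := LinearMap.congr_fun hαj c
    have h2 : r (s (c • x)) = c • x := LinearMap.congr_fun hrs _
    change f.hom (r (j (α c))) = c
    rw [h1, h2, map_smul]
    exact (congrArg (c • ·) hx).trans (mul_one c)
  constructor
  · intro N hN
    exact IsFadd.finite hG.fin ((mem_addCl_iff M N).1 hN)
  · intro A hA
    obtain ⟨k, g, hg⟩ := hG.right A hA
    exact ⟨ModuleCat.of Λ (Fin k → M), (mem_addCl_iff _ _).2 (IsFadd.pow k), ModuleCat.ofHom g,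
      surj_of_lift hgen g hg⟩
  · intro A hA
    have : Module.Finite Λ A := hA
    obtain ⟨N, hN, f, hf⟩ := h.cogenerating A trivial
    obtain ⟨k, g, hg⟩ := inj_pow ((mem_AddCl_iff M N).1 hN) f.hom hf
    exact ⟨ModuleCat.of Λ (Fin k → M), (mem_addCl_iff _ _).2 (IsFadd.pow k), ModuleCat.ofHom g, hg⟩
  · intro A hA
    obtain ⟨k, g, hg⟩ := hG.right A hA
    refine ⟨ModuleCat.of Λ (Fin k → M), (mem_addCl_iff _ _).2 (IsFadd.pow k), ModuleCat.ofHom g,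
      fun N hN u => ?_⟩
    obtain ⟨t, ht⟩ := lift_isAdd ((mem_addCl_iff M N).1 hN).isAdd g hg u.hom
    exact ⟨ModuleCat.ofHom t, ModuleCat.hom_ext ht⟩
  · intro A hA
    obtain ⟨k, g, hg⟩ := hG.left A hA
    refine ⟨ModuleCat.of Λ (Fin k → M), (mem_addCl_iff _ _).2 (IsFadd.pow k), ModuleCat.ofHom g,
      fun N hN u => ?_⟩
    obtain ⟨t, ht⟩ := ext_isFadd ((mem_addCl_iff M N).1 hN) g hg u.hom
    exact ⟨ModuleCat.ofHom t, ModuleCat.hom_ext ht⟩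
  · intro X hX
    have : Module.Finite Λ X := hX
    rw [hiff X hX, h.char_left X trivial]
    constructor
    · intro H i hi hin N hN
      exact H i hi hin N ((mem_AddCl_iff M N).2 ((mem_addCl_iff M N).1 hN).isAdd)
    · intro H i hi hin N hN
      rw [extZero_iff hi]
      exact ((mem_AddCl_iff M N).1 hN).ez_right hi ((extZero_iff hi _ _).1 (H i hi hin M hMm))
  · intro X hX
    rw [hiff X hX, h.char_right X trivial]
    constructor
    · intro H i hi hin N hN
      exact H i hi hin N ((mem_AddCl_iff M N).2 ((mem_addCl_iff M N).1 hN).isAdd)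
    · intro H i hi hin N hN
      rw [extZero_iff hi]
      exact ((mem_AddCl_iff M N).1 hN).ez_left hi ((extZero_iff hi _ _).1 (H i hi hin M hMm))

lemma big_of_small (M : ModuleCat.{0} Λ) (hG : Good Λ M) (n : ℕ) (hn : 0 < n)
    (h : IsNClusterTilting n (modFG Λ) (addCl {M})) :
    IsNClusterTilting n Set.univ (AddCl {M}) := by
  have := hG.noeth
  have := hG.fin
  have hMm : M ∈ addCl {M} := (mem_addCl_iff M M).2 IsFadd.self
  have hMf : M ∈ modFG Λ := hG.fin
  have hgen : IsGen Λ M := by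
    obtain ⟨N, hN, f, hf⟩ := h.generating (ModuleCat.of Λ Λ)
      (inferInstanceAs (Module.Finite Λ Λ))
    exact isGen_of_surj ((mem_addCl_iff M N).1 hN) f.hom hf
  have hcog : ∀ (F : Type) [AddCommGroup F] [Module Λ F], Module.Finite Λ F →
      ∃ (k : ℕ) (f : F →ₗ[Λ] (Fin k → M)), Function.Injective f := by
    intro F _ _ hF
    obtain ⟨N, hN, f, hf⟩ := h.cogenerating (ModuleCat.of Λ F) hF
    exact inj_pow ((mem_addCl_iff M N).1 hN).isAdd f.hom hf
  have hself : ∀ i, 0 < i → i < n → EZ Λ i M M := fun i hi hin =>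
    (extZero_iff hi M M).1 ((h.char_left M hMf).1 hMm i hi hin M hMm)
  have hR : ∀ (F : Type) [AddCommGroup F] [Module Λ F], Module.Finite Λ F →
      (∀ i, 0 < i → i < n → EZ Λ i M F) → IsFadd Λ M F := by
    intro F _ _ hF H
    refine (mem_addCl_iff M (ModuleCat.of Λ F)).1 ((h.char_right _ hF).2 fun i hi hin N hN => ?_)
    rw [extZero_iff hi]
    exact ((mem_addCl_iff M N).1 hN).isAdd.ez_left hi (H i hi hin)
  have hmem : ∀ (N : Type) [AddCommGroup N] [Module Λ N], IsAdd Λ M N →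
      ModuleCat.of Λ N ∈ AddCl {M} := fun N _ _ hN => (mem_AddCl_iff M _).2 hN
  constructor
  · exact fun _ _ => trivial
  · intro A _
    exact ⟨_, hmem _ (IsAdd.finsupp _), ModuleCat.ofHom (apx Λ M A),
      surj_of_lift hgen _ apx_lift⟩
  · intro A _
    obtain ⟨N, _, _, hN, f, hf⟩ := exists_embedding hG hgen hcog A
    exact ⟨_, hmem N hN, ModuleCat.ofHom f, hf⟩
  · intro A _
    refine ⟨_, hmem _ (IsAdd.finsupp _), ModuleCat.ofHom (apx Λ M A), fun N hN u => ?_⟩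
    obtain ⟨t, ht⟩ := lift_isAdd ((mem_AddCl_iff M N).1 hN) _ apx_lift u.hom
    exact ⟨ModuleCat.ofHom t, ModuleCat.hom_ext ht⟩
  · intro A _
    obtain ⟨N, _, _, hN, f, hf⟩ := exists_left_apx hG hgen A
    refine ⟨_, hmem N hN, ModuleCat.ofHom f, fun N' hN' u => ?_⟩
    obtain ⟨t, ht⟩ := hf N' ((mem_AddCl_iff M N').1 hN') u.hom
    exact ⟨ModuleCat.ofHom t, ModuleCat.hom_ext ht⟩
  · intro X _
    constructor
    · intro hX i hi hin N hN
      rw [extZero_iff hi]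
      exact ez_add hG hself ((mem_AddCl_iff M X).1 hX) ((mem_AddCl_iff M N).1 hN) hi hin
    · intro H
      rw [mem_AddCl_iff]
      exact big_left hG hgen hn hself hR X fun i hi hin M' _ _ hM' =>
        (extZero_iff hi X (ModuleCat.of Λ M')).1 (H i hi hin _ (hmem M' hM'))
  · intro X _
    constructor
    · intro hX i hi hin N hN
      rw [extZero_iff hi]
      exact ez_add hG hself ((mem_AddCl_iff M N).1 hN) ((mem_AddCl_iff M X).1 hX) hi hin
    · intro H
      rw [mem_AddCl_iff]
      exact big_right hG hgen hcog hn hself hR (n - 1) X 0 (by omega)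
        (fun i hi hi' => by omega) fun i hi hin M' _ _ hM' =>
        (extZero_iff hi (ModuleCat.of Λ M') X).1 (H i hi (by omega) _ (hmem M' hM'))

end Bridge

theorem stmt4 (R : Type) [CommRing R] [IsArtinianRing R]
    [Algebra R Λ] [Module.Finite R Λ]
    (n : ℕ) (hn : 0 < n) (M : ModuleCat Λ) (hM : Module.Finite Λ M) :
    IsNClusterTilting n Set.univ (AddCl {M}) ↔
      IsNClusterTilting n (modFG Λ) (addCl {M}) := by
  have hG : Good Λ M := good_of_artin R M hM
  exact ⟨small_of_big M hG n, big_of_small M hG n hn⟩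

end Paper
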